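/- Let G be a non-compact group equipped with a T0 Alexandroff topology making G a paratopological group (multiplication continuous). Then G is hyperconnected if and only if G is ultraconnected; that is, every pair of nonempty open subsets of G has nonempty intersection if and only if every pair of nonempty closed subsets of G has nonempty intersection. -/

import Mathlib

open Topology in
/-- Inversion in a paratopological group reverses the specialization order. -/
theorem Specializes.inv_reverse {G : Type*} [Group G] [TopologicalSpace G] [ContinuousMul G]
    {x y : G} (h : x ⤳ y) : y⁻¹ ⤳ x⁻¹ := by
  have key : (x⁻¹ * x * y⁻¹) ⤳ (x⁻¹ * y * y⁻¹) :=
    h.map (f := fun g ↦ x⁻¹ * g * y⁻¹) (by fun_prop)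
  simpa using key

/-- A non-compact Alexandroff paratopological group is hyperconnected if and only if it is
ultraconnected: every pair of nonempty open sets intersects iff every pair of nonempty
closed sets intersects. -/
theorem hyperconnected_iff_ultraconnected
    (G : Type*) [Group G] [TopologicalSpace G] [AlexandrovDiscrete G] [T0Space G]
    [ContinuousMul G] [NoncompactSpace G] :
    (∀ U V : Set G, IsOpen U → IsOpen V → U.Nonempty → V.Nonempty → (U ∩ V).Nonempty) ↔
      (∀ U V : Set G, IsClosed U → IsClosed V → U.Nonempty → V.Nonempty →
        (U ∩ V).Nonempty) := by
  constructor
  · rintro h U V hU hV ⟨x, hx⟩ ⟨y, hy⟩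
    obtain ⟨z, hzx, hzy⟩ := h (nhdsKer {x⁻¹}) (nhdsKer {y⁻¹}) isOpen_nhdsKer isOpen_nhdsKer
      ⟨_, subset_nhdsKer rfl⟩ ⟨_, subset_nhdsKer rfl⟩
    rw [mem_nhdsKer_singleton] at hzx hzy
    refine ⟨z⁻¹, Specializes.mem_closed ?_ hU hx, Specializes.mem_closed ?_ hV hy⟩
    · simpa using hzx.inv_reverse
    · simpa using hzy.inv_reverse
  · rintro h U V hU hV ⟨x, hx⟩ ⟨y, hy⟩
    obtain ⟨z, hxz, hyz⟩ := h (closure {x⁻¹}) (closure {y⁻¹}) isClosed_closure isClosed_closure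
      ⟨_, subset_closure rfl⟩ ⟨_, subset_closure rfl⟩
    rw [← specializes_iff_mem_closure] at hxz hyz
    refine ⟨z⁻¹, Specializes.mem_open ?_ hU hx, Specializes.mem_open ?_ hV hy⟩
    · simpa using hxz.inv_reverse
    · simpa using hyz.inv_reverse
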